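/- Let f be a profile function, let k ≥ 1 be an integer, and let μ : ℕ → ℝ be a strictly increasing function whose range is Spec L_k (the increasing enumeration of the eigenvalues of L_k). Then every μ(j) is positive and the series of reciprocals converges with ∑'_{j=0}^{∞} 1/μ(j) = 1/k. -/

import Mathlib

open Set MeasureTheory intervalIntegral Filter

/-- A profile function for a surface of revolution diffeomorphic to `S²` of area `4π`:
continuous on `[-1,1]`, smooth and positive on `(-1,1)`, vanishing at `±1`,
with derivative `2` at `-1` and `-2` at `1`. -/
structure IsProfile (f : ℝ → ℝ) : Prop where
  contOn : ContinuousOn f (Icc (-1) 1)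
  smoothOn : ContDiffOn ℝ (⊤ : ℕ∞) f (Ioo (-1) 1)
  pos : ∀ x ∈ Ioo (-1:ℝ) 1, 0 < f x
  zero_neg_one : f (-1) = 0
  zero_one : f 1 = 0
  deriv_neg_one : HasDerivAt f 2 (-1)
  deriv_one : HasDerivAt f (-2) 1

/-- `λ` is an eigenvalue of the Sturm–Liouville operator
`L_k = -(d/dx)(f(x) d/dx) + k²/f(x)` on `(-1,1)`, with Dirichlet boundary
conditions at `±1` when `k ≥ 1`. -/
def InSpec (f : ℝ → ℝ) (k : ℕ) (lam : ℝ) : Prop :=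
  ∃ u : ℝ → ℝ, ContinuousOn u (Icc (-1) 1) ∧ ContDiffOn ℝ (⊤ : ℕ∞) u (Ioo (-1) 1) ∧
    (∃ x ∈ Ioo (-1:ℝ) 1, u x ≠ 0) ∧
    (1 ≤ k → u (-1) = 0 ∧ u 1 = 0) ∧
    ∀ x ∈ Ioo (-1:ℝ) 1,
      -(deriv (fun y => f y * deriv u y) x) + ((k:ℝ)^2 / f x) * u x = lam * u x

/-- The spectrum of `L_k`. -/
def Spec (f : ℝ → ℝ) (k : ℕ) : Set ℝ := {lam | InSpec f k lam}

/-- The set of distinct eigenvalues of the Laplacian of the surface of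
revolution determined by `f`. -/
def Eigs (f : ℝ → ℝ) : Set ℝ := ⋃ k : ℕ, Spec f k

section FrameOperator

variable {X F : Type*} [MeasurableSpace X] [NormedAddCommGroup F] [InnerProductSpace ℝ F]

/-- The frame operator `v ↦ ∫ ⟪Φ x, v⟫ Φ x dρ(x)` of a family of vectors `Φ`. -/
noncomputable def frameOp (ρ : Measure X) (Φ : X → F) : F →L[ℝ] F :=
  ∫ x, InnerProductSpace.rankOne ℝ (Φ x) (Φ x) ∂ρ

variable {ρ : Measure X} [IsFiniteMeasure ρ] {Φ : X → F} {C : ℝ}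

lemma integrable_rankOne_self (hΦ : AEStronglyMeasurable Φ ρ) (hC : ∀ᵐ x ∂ρ, ‖Φ x‖ ≤ C) :
    Integrable (fun x => InnerProductSpace.rankOne ℝ (Φ x) (Φ x)) ρ := by
  refine Integrable.of_bound (C := C * C) ?_ ?_
  · have h1 : Continuous fun v : F => InnerProductSpace.rankOne ℝ v v :=
      (InnerProductSpace.rankOne ℝ (E := F) (F := F)).continuous.clm_apply continuous_id
    exact h1.comp_aestronglyMeasurable hΦ
  · filter_upwards [hC] with x hx
    rw [InnerProductSpace.norm_rankOne]
    exact mul_le_mul hx hx (norm_nonneg _) ((norm_nonneg _).trans hx)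

lemma frameOp_apply (hΦ : AEStronglyMeasurable Φ ρ) (hC : ∀ᵐ x ∂ρ, ‖Φ x‖ ≤ C) (v : F) :
    frameOp ρ Φ v = ∫ x, inner ℝ (Φ x) v • Φ x ∂ρ := by
  rw [frameOp, ContinuousLinearMap.integral_apply (integrable_rankOne_self hΦ hC)]
  rfl

variable [CompleteSpace F]

lemma inner_frameOp (hΦ : AEStronglyMeasurable Φ ρ) (hC : ∀ᵐ x ∂ρ, ‖Φ x‖ ≤ C) (v w : F) :
    inner ℝ w (frameOp ρ Φ v) = ∫ x, inner ℝ (Φ x) v * inner ℝ (Φ x) w ∂ρ := by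
  have hi : Integrable (fun x => inner ℝ (Φ x) v • Φ x) ρ :=
    (integrable_rankOne_self hΦ hC).apply_continuousLinearMap v
  rw [frameOp_apply hΦ hC, ← integral_inner hi]
  simp only [real_inner_smul_right, real_inner_comm w]

lemma frameOp_isSymmetric (hΦ : AEStronglyMeasurable Φ ρ) (hC : ∀ᵐ x ∂ρ, ‖Φ x‖ ≤ C) :
    (frameOp ρ Φ).IsSymmetric := by
  intro v w
  change inner ℝ (frameOp ρ Φ v) w = inner ℝ v (frameOp ρ Φ w)
  rw [real_inner_comm, inner_frameOp hΦ hC, inner_frameOp hΦ hC]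
  simp only [mul_comm]

lemma frameOp_isCompactOperator (hΦ : AEStronglyMeasurable Φ ρ) (hC : ∀ᵐ x ∂ρ, ‖Φ x‖ ≤ C) :
    IsCompactOperator (frameOp ρ Φ) := by
  rcases eq_or_ne ρ 0 with rfl | h0
  · simpa [frameOp] using isCompactOperator_zero
  have : NeZero ρ := ⟨h0⟩
  have hav : ⨍ x, InnerProductSpace.rankOne ℝ (Φ x) (Φ x) ∂ρ ∈
      (compactOperator (RingHom.id ℝ) F F : Set (F →L[ℝ] F)) := by
    refine (compactOperator (RingHom.id ℝ) F F).convex.average_mem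
      isClosed_setOfPred_isCompactOperator (ae_of_all _ fun x => ?_) (integrable_rankOne_self hΦ hC)
    have hcomp : IsCompactOperator (innerSL ℝ (Φ x)) :=
      isCompactOperator_of_locallyCompactSpace_dom _
    exact hcomp.clm_comp (ContinuousLinearMap.toSpanSingleton ℝ (Φ x))
  have h := (compactOperator (RingHom.id ℝ) F F).smul_mem (ρ.real univ) hav
  rwa [measure_smul_average] at h

/-- If the eigenvectors of the frame operator contain a Hilbert basis, its trace is
`∫ ‖Φ x‖² dρ(x)`. -/
lemma hasSum_eigenvalues_frameOp (hΦ : AEStronglyMeasurable Φ ρ) (hC : ∀ᵐ x ∂ρ, ‖Φ x‖ ≤ C)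
    {ι : Type*} [Countable ι] (e : HilbertBasis ι ℝ F) (ν : ι → ℝ)
    (he : ∀ j, frameOp ρ Φ (e j) = ν j • e j) : HasSum ν (∫ x, ‖Φ x‖ ^ 2 ∂ρ) := by
  have hsum : ∀ x, HasSum (fun j => inner ℝ (Φ x) (e j) ^ 2) (‖Φ x‖ ^ 2) := by
    intro x
    have := e.hasSum_inner_mul_inner (Φ x) (Φ x)
    simpa only [real_inner_comm (Φ x), ← sq, real_inner_self_eq_norm_sq] using this
  have hν : ν = fun j => ∫ x, inner ℝ (Φ x) (e j) ^ 2 ∂ρ := by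
    funext j
    have h := inner_frameOp hΦ hC (e j) (e j)
    rw [he, real_inner_smul_right, real_inner_self_eq_norm_sq, e.orthonormal.1 j] at h
    simpa [sq] using h
  rw [hν]
  refine hasSum_integral_of_dominated_convergence (fun j x => inner ℝ (Φ x) (e j) ^ 2)
    (fun j => ((hΦ.inner aestronglyMeasurable_const).pow 2))
    (fun j => ae_of_all _ fun x => by simp) (ae_of_all _ fun x => (hsum x).summable) ?_
    (ae_of_all _ hsum)
  simp only [(hsum _).tsum_eq]
  refine Integrable.of_bound (hΦ.norm.pow 2) (C ^ 2) ?_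
  filter_upwards [hC] with x hx
  rw [Real.norm_of_nonneg (by positivity)]
  gcongr

/-- Trace formula for an injective frame operator with simple nonzero eigenvalues. -/
lemma hasSum_simple_eigenvalues_frameOp (hΦ : AEStronglyMeasurable Φ ρ)
    (hC : ∀ᵐ x ∂ρ, ‖Φ x‖ ≤ C) (hinj : ∀ v, frameOp ρ Φ v = 0 → v = 0)
    {ι : Type*} [Countable ι] {ν : ι → ℝ} (hν : Function.Injective ν) {e : ι → F}
    (he0 : ∀ j, e j ≠ 0) (he : ∀ j, frameOp ρ Φ (e j) = ν j • e j)
    (hspan : ∀ (v : F) (r : ℝ), r ≠ 0 → v ≠ 0 → frameOp ρ Φ v = r • v → ∃ j, ∃ c : ℝ, v = c • e j) :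
    HasSum ν (∫ x, ‖Φ x‖ ^ 2 ∂ρ) := by
  have hsymm := frameOp_isSymmetric hΦ hC
  let b : ι → F := fun j => ‖e j‖⁻¹ • e j
  have hb : ∀ j, frameOp ρ Φ (b j) = ν j • b j := fun j => by
    simp only [b, map_smul, he, smul_comm (ν j)]
  have hortho : Orthonormal ℝ b := by
    refine ⟨fun j => norm_smul_inv_norm (𝕜 := ℝ) (he0 j), fun i j hij => ?_⟩
    have h : inner ℝ (frameOp ρ Φ (b i)) (b j) = inner ℝ (b i) (frameOp ρ Φ (b j)) :=
      hsymm (b i) (b j)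
    rw [hb, hb, real_inner_smul_left, real_inner_smul_right (b i) (b j)] at h
    exact (mul_eq_mul_right_iff.1 h).resolve_left fun h' => hij (hν h')
  have hbot : (Submodule.span ℝ (range b))ᗮ = ⊥ := by
    rw [eq_bot_iff, ← ContinuousLinearMap.orthogonalComplement_iSup_eigenspaces_eq_bot
      (frameOp_isCompactOperator hΦ hC) hsymm]
    refine Submodule.orthogonal_le (iSup_le fun r v hv => ?_)
    have hv' : frameOp ρ Φ v = r • v := Module.End.mem_eigenspace_iff.1 hv
    rcases eq_or_ne v 0 with rfl | hv0
    · exact zero_mem _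
    rcases eq_or_ne r 0 with rfl | hr
    · exact absurd (hinj v (by simpa using hv')) hv0
    obtain ⟨j, c, rfl⟩ := hspan v r hr hv0 hv'
    have : e j = ‖e j‖ • b j := by
      simp only [b, smul_smul]
      rw [mul_inv_cancel₀ (norm_ne_zero_iff.2 (he0 j)), one_smul]
    rw [this]
    exact Submodule.smul_mem _ _ (Submodule.smul_mem _ _ (Submodule.subset_span ⟨j, rfl⟩))
  refine hasSum_eigenvalues_frameOp hΦ hC (HilbertBasis.mkOfOrthogonalEqBot hortho hbot) ν ?_
  simpa using hb

end FrameOperator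

/-- Uniqueness for the linear system `w' = p / f`, `p' = q w` on an open interval. -/
lemma eqOn_zero_of_linear_system {a b x₀ : ℝ} {f q w p : ℝ → ℝ} (hfc : ContinuousOn f (Ioo a b))
    (hf : ∀ x ∈ Ioo a b, 0 < f x) (hq : ContinuousOn q (Ioo a b))
    (hw : ∀ x ∈ Ioo a b, HasDerivAt w (p x / f x) x)
    (hp : ∀ x ∈ Ioo a b, HasDerivAt p (q x * w x) x)
    (hx₀ : x₀ ∈ Ioo a b) (hw₀ : w x₀ = 0) (hp₀ : p x₀ = 0) :
    EqOn w 0 (Ioo a b) := by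
  intro x hx
  obtain ⟨c, hac, hc⟩ := exists_between (lt_min hx.1 hx₀.1)
  obtain ⟨d, hd, hdb⟩ := exists_between (max_lt hx.2 hx₀.2)
  have hsub : Icc c d ⊆ Ioo a b := fun y hy => ⟨hac.trans_le hy.1, hy.2.trans_lt hdb⟩
  obtain ⟨A, hA⟩ := isCompact_Icc.exists_bound_of_continuousOn
    (((hfc.inv₀ fun x hx => (hf x hx).ne')).mono hsub)
  obtain ⟨B, hB⟩ := isCompact_Icc.exists_bound_of_continuousOn (hq.mono hsub)
  let v : ℝ → ℝ × ℝ → ℝ × ℝ := fun t z => ((f t)⁻¹ * z.2, q t * z.1)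
  have hv : ∀ t ∈ Ioo c d, LipschitzOnWith (max A B).toNNReal (v t) univ := by
    intro t ht
    refine LipschitzOnWith.of_dist_le_mul fun y _ z _ => ?_
    have hM := Real.le_coe_toNNReal (max A B)
    have h1 := (hA t (Ioo_subset_Icc_self ht)).trans ((le_max_left A B).trans hM)
    have h2 := (hB t (Ioo_subset_Icc_self ht)).trans ((le_max_right A B).trans hM)
    simp only [v, Prod.dist_eq, Real.dist_eq, ← mul_sub, abs_mul]
    refine max_le ?_ ?_
    · exact mul_le_mul h1 (le_max_right _ _) (abs_nonneg _) (NNReal.coe_nonneg _)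
    · exact mul_le_mul h2 (le_max_left _ _) (abs_nonneg _) (NNReal.coe_nonneg _)
  have key := ODE_solution_unique_of_mem_Ioo (f := fun t => (w t, p t)) (g := fun _ => 0)
    (t₀ := x₀) hv ⟨hc.trans_le (min_le_right _ _), (le_max_right _ _).trans_lt hd⟩
    (fun t ht => ⟨?_, mem_univ _⟩) (fun t _ => ⟨?_, mem_univ _⟩) (by simp [hw₀, hp₀])
  · have := key ⟨hc.trans_le (min_le_left _ _), (le_max_left _ _).trans_lt hd⟩
    exact congrArg Prod.fst this
  · have ht' := hsub (Ioo_subset_Icc_self ht)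
    have := (hw t ht').prodMk (hp t ht')
    simpa [v, div_eq_inv_mul] using this
  · convert hasDerivAt_const t (0 : ℝ × ℝ) using 1
    simp [v]

/-- If `s' = 1 / f` near `1` and `f` vanishes linearly at `1`, then `s` blows up at `1`. -/
lemma tendsto_atTop_of_hasDerivAt_inv {f s : ℝ → ℝ} (hpos : ∀ x ∈ Ioo (-1 : ℝ) 1, 0 < f x)
    (h1 : f 1 = 0) (hd : HasDerivAt f (-2) 1)
    (hs : ∀ x ∈ Ioo (-1 : ℝ) 1, HasDerivAt s (1 / f x) x) :
    Tendsto s (nhdsWithin 1 (Iio 1)) atTop := by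
  have hlin : ∀ᶠ y in nhdsWithin (1 : ℝ) (Iio 1), f y ≤ 3 * (1 - y) := by
    have := (hasDerivAt_iff_isLittleO.1 hd).def one_pos
    filter_upwards [nhdsWithin_le_nhds this, self_mem_nhdsWithin] with y hy hy1
    have hy1' : y - 1 < 0 := sub_neg.2 hy1
    rw [h1, smul_eq_mul, Real.norm_eq_abs, Real.norm_eq_abs, abs_of_neg hy1'] at hy
    linarith [(abs_le.1 hy).2]
  obtain ⟨a, ha, hlin⟩ := (mem_nhdsLT_iff_exists_Ioo_subset).1 hlin
  have ha1 : a < 1 := ha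
  obtain ⟨c, hc, hc1⟩ := exists_between (max_lt ha1 (show (-1 : ℝ) < 1 by norm_num))
  have hca : a < c := (le_max_left _ _).trans_lt hc
  have hcn : -1 < c := (le_max_right _ _).trans_lt hc
  have hder : ∀ x ∈ Ico c 1, HasDerivAt (fun y => s y + 1 / 3 * Real.log (1 - y))
      (1 / f x + 1 / 3 * (-1 / (1 - x))) x := fun x hx =>
    (hs x ⟨hcn.trans_le hx.1, hx.2⟩).add
      ((((hasDerivAt_id x).const_sub 1).log (sub_pos.2 hx.2).ne').const_mul _)
  have hmono : MonotoneOn (fun y => s y + 1 / 3 * Real.log (1 - y)) (Ico c 1) := by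
    refine monotoneOn_of_hasDerivWithinAt_nonneg (convex_Ico c 1)
      (HasDerivAt.continuousOn hder)
      (fun x hx => (hder x (interior_subset hx)).hasDerivWithinAt) fun x hx => ?_
    have hx' := interior_subset hx
    have h1x : 0 < 1 - x := sub_pos.2 hx'.2
    have hfx := hpos x ⟨hcn.trans_le hx'.1, hx'.2⟩
    have hle : f x ≤ 3 * (1 - x) := hlin ⟨hca.trans_le hx'.1, hx'.2⟩
    have := one_div_le_one_div_of_le hfx hle
    have heq : 1 / 3 * (-1 / (1 - x)) = -(1 / (3 * (1 - x))) := by field_simp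
    rw [heq]
    linarith
  have hlog : Tendsto (fun y : ℝ => s c + 1 / 3 * Real.log (1 - c) + 1 / 3 * -Real.log (1 - y))
      (nhdsWithin 1 (Iio 1)) atTop := by
    refine tendsto_atTop_add_const_left _ _ (Tendsto.const_mul_atTop (by norm_num) ?_)
    refine tendsto_neg_atBot_atTop.comp (Real.tendsto_log_nhdsGT_zero.comp ?_)
    refine tendsto_nhdsWithin_iff.2 ⟨?_, ?_⟩
    · have : Continuous fun y : ℝ => 1 - y := by fun_prop
      exact tendsto_nhdsWithin_of_tendsto_nhds (this.tendsto' _ _ (sub_self 1))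
    · filter_upwards [self_mem_nhdsWithin] with y hy
      exact sub_pos.2 (mem_Iio.1 hy)
  refine tendsto_atTop_mono' _ ?_ hlog
  filter_upwards [Ico_mem_nhdsLT hc1] with y hy
  have := hmono ⟨le_rfl, hc1⟩ hy hy.1
  simp only at this
  linarith

/-- `φ` is the solution of `f φ' = k φ` on `(-1,1)` growing from `0` to `∞`; then `φ` and `φ⁻¹`
span the solutions of `L_k u = 0`. -/
structure IsExpSolution (f : ℝ → ℝ) (k : ℝ) (φ : ℝ → ℝ) : Prop where
  pos : ∀ x ∈ Ioo (-1 : ℝ) 1, 0 < φ x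
  hasDerivAt : ∀ x ∈ Ioo (-1 : ℝ) 1, HasDerivAt φ (k * φ x / f x) x
  tendsto_one : Tendsto φ (nhdsWithin 1 (Iio 1)) atTop
  tendsto_neg_one : Tendsto φ (nhdsWithin (-1) (Ioi (-1))) (nhds 0)

lemma IsProfile.exists_isExpSolution {f : ℝ → ℝ} (hf : IsProfile f) {k : ℝ} (hk : 0 < k) :
    ∃ φ, IsExpSolution f k φ := by
  have hI : IsOpen (Ioo (-1 : ℝ) 1) := isOpen_Ioo
  have hinv : ContinuousOn (fun x => 1 / f x) (Ioo (-1) 1) :=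
    continuousOn_const.div hf.smoothOn.continuousOn fun x hx => (hf.pos x hx).ne'
  let s : ℝ → ℝ := fun x => ∫ t in (0 : ℝ)..x, 1 / f t
  have hs : ∀ x ∈ Ioo (-1 : ℝ) 1, HasDerivAt s (1 / f x) x := by
    intro x hx
    have hsub : uIcc 0 x ⊆ Ioo (-1 : ℝ) 1 :=
      ordConnected_Ioo.uIcc_subset (by norm_num) hx
    exact integral_hasDerivAt_right (hinv.mono hsub).intervalIntegrable
      (hinv.stronglyMeasurableAtFilter hI x hx) (hinv.continuousAt (hI.mem_nhds hx))
  have htop : Tendsto s (nhdsWithin 1 (Iio 1)) atTop :=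
    tendsto_atTop_of_hasDerivAt_inv hf.pos hf.zero_one hf.deriv_one hs
  have hneg : ∀ x ∈ Ioo (-1 : ℝ) 1, -x ∈ Ioo (-1 : ℝ) 1 := fun x hx =>
    ⟨by linarith [hx.2], by linarith [hx.1]⟩
  have htop' : Tendsto (fun x => -s (-x)) (nhdsWithin 1 (Iio 1)) atTop := by
    refine tendsto_atTop_of_hasDerivAt_inv (f := fun x => f (-x))
      (fun x hx => hf.pos _ (hneg x hx)) hf.zero_neg_one ?_ fun x hx => ?_
    · simpa [Function.comp_def] using
        HasDerivAt.comp (1 : ℝ) hf.deriv_neg_one (hasDerivAt_neg 1)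
    · simpa [Function.comp_def] using
        (HasDerivAt.comp x (hs _ (hneg x hx)) (hasDerivAt_neg x)).fun_neg
  have hbot : Tendsto s (nhdsWithin (-1) (Ioi (-1))) atBot := by
    have := tendsto_neg_atTop_atBot.comp (htop'.comp (tendsto_neg_nhdsGT_neg (a := (1 : ℝ))))
    simpa [Function.comp_def] using this
  refine ⟨fun x => Real.exp (k * s x), fun x _ => Real.exp_pos _, fun x hx => ?_, ?_, ?_⟩
  · convert ((hs x hx).const_mul k).exp using 1
    ring
  · exact Real.tendsto_exp_atTop.comp (htop.const_mul_atTop hk)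
  · exact Real.tendsto_exp_atBot.comp (hbot.const_mul_atBot hk)

section Green

variable {f φ u : ℝ → ℝ} {k C : ℝ}

/-- The Green kernel of `L_k` in terms of the increasing solution `φ` of `f φ' = k φ`. -/
noncomputable def greenKernel (k : ℝ) (φ : ℝ → ℝ) (x y : ℝ) : ℝ :=
  (2 * k)⁻¹ * (min (φ x) (φ y) ^ 2 / (φ x * φ y))

/-- The solution of `L_k R = u` vanishing at `±1`. -/
noncomputable def greenPotential (k : ℝ) (φ u : ℝ → ℝ) (x : ℝ) : ℝ :=
  ∫ y in Ioo (-1 : ℝ) 1, greenKernel k φ x y * u y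

/-- The flux `f R'` of the solution `R` of `L_k R = u`. -/
noncomputable def greenFlux (φ u : ℝ → ℝ) (x : ℝ) : ℝ :=
  2⁻¹ * (φ x * (∫ y in x..1, (φ y)⁻¹ * u y) - (φ x)⁻¹ * ∫ y in (-1)..x, φ y * u y)

namespace IsExpSolution

lemma continuousOn (hφ : IsExpSolution f k φ) : ContinuousOn φ (Ioo (-1) 1) :=
  HasDerivAt.continuousOn hφ.hasDerivAt

lemma monotoneOn (hφ : IsExpSolution f k φ) (hf : ∀ x ∈ Ioo (-1 : ℝ) 1, 0 < f x) (hk : 0 < k) :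
    MonotoneOn φ (Ioo (-1) 1) :=
  monotoneOn_of_hasDerivWithinAt_nonneg (convex_Ioo _ _) hφ.continuousOn
    (fun x hx => (hφ.hasDerivAt x (interior_subset hx)).hasDerivWithinAt) fun x hx =>
      div_nonneg (mul_nonneg hk.le (hφ.pos x (interior_subset hx)).le)
        (hf x (interior_subset hx)).le

lemma continuousOn_inv (hφ : IsExpSolution f k φ) :
    ContinuousOn (fun x => (φ x)⁻¹) (Ioo (-1) 1) :=
  hφ.continuousOn.inv₀ fun x hx => (hφ.pos x hx).ne'

lemma greenKernel_of_le (hφ : IsExpSolution f k φ) {x y : ℝ} (hx : x ∈ Ioo (-1 : ℝ) 1)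
    (hy : y ∈ Ioo (-1 : ℝ) 1) (h : φ x ≤ φ y) :
    greenKernel k φ x y = (2 * k)⁻¹ * (φ x * (φ y)⁻¹) := by
  have := hφ.pos x hx
  have := hφ.pos y hy
  rw [greenKernel, min_eq_left h]
  field_simp

lemma greenKernel_of_ge (hφ : IsExpSolution f k φ) {x y : ℝ} (hx : x ∈ Ioo (-1 : ℝ) 1)
    (hy : y ∈ Ioo (-1 : ℝ) 1) (h : φ y ≤ φ x) :
    greenKernel k φ x y = (2 * k)⁻¹ * ((φ x)⁻¹ * φ y) := by
  have := hφ.pos x hx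
  have := hφ.pos y hy
  rw [greenKernel, min_eq_right h]
  field_simp

lemma greenKernel_nonneg (hφ : IsExpSolution f k φ) (hk : 0 < k) {x y : ℝ}
    (hx : x ∈ Ioo (-1 : ℝ) 1) (hy : y ∈ Ioo (-1 : ℝ) 1) : 0 ≤ greenKernel k φ x y := by
  have := hφ.pos x hx
  have := hφ.pos y hy
  rw [greenKernel]
  positivity

lemma greenKernel_le (hφ : IsExpSolution f k φ) (hk : 0 < k) {x y : ℝ}
    (hx : x ∈ Ioo (-1 : ℝ) 1) (hy : y ∈ Ioo (-1 : ℝ) 1) :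
    greenKernel k φ x y ≤ (2 * k)⁻¹ * min (φ x * (φ y)⁻¹) ((φ x)⁻¹ * φ y) := by
  have h1 := hφ.pos x hx
  have h2 := hφ.pos y hy
  rcases le_total (φ x) (φ y) with h | h
  · rw [hφ.greenKernel_of_le hx hy h]
    gcongr
    refine le_min le_rfl ?_
    rw [← div_eq_mul_inv, ← div_eq_inv_mul, div_le_div_iff₀ h2 h1]
    nlinarith
  · rw [hφ.greenKernel_of_ge hx hy h]
    gcongr
    refine le_min ?_ le_rfl
    rw [← div_eq_mul_inv, ← div_eq_inv_mul, div_le_div_iff₀ h1 h2]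
    nlinarith

lemma greenKernel_le_const (hφ : IsExpSolution f k φ) (hk : 0 < k) {x y : ℝ}
    (hx : x ∈ Ioo (-1 : ℝ) 1) (hy : y ∈ Ioo (-1 : ℝ) 1) : greenKernel k φ x y ≤ (2 * k)⁻¹ := by
  have h1 := hφ.pos x hx
  have h2 := hφ.pos y hy
  refine (hφ.greenKernel_le hk hx hy).trans (mul_le_of_le_one_right (by positivity) ?_)
  rcases le_total (φ x) (φ y) with h | h
  · exact (min_le_left _ _).trans (by rwa [← div_eq_mul_inv, div_le_one h2])
  · exact (min_le_right _ _).trans (by rwa [← div_eq_inv_mul, div_le_one h1])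

lemma continuousOn_greenKernel_left (hφ : IsExpSolution f k φ) {y : ℝ}
    (hy : y ∈ Ioo (-1 : ℝ) 1) : ContinuousOn (fun x => greenKernel k φ x y) (Ioo (-1) 1) :=
  continuousOn_const.mul (((hφ.continuousOn.inf continuousOn_const).pow 2).div
    (hφ.continuousOn.mul continuousOn_const) fun x hx =>
      (mul_pos (hφ.pos x hx) (hφ.pos y hy)).ne')

lemma greenKernel_symm (x y : ℝ) : greenKernel k φ x y = greenKernel k φ y x := by
  rw [greenKernel, greenKernel, min_comm, mul_comm (φ x)]

lemma continuousOn_greenKernel_right (hφ : IsExpSolution f k φ) {x : ℝ}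
    (hx : x ∈ Ioo (-1 : ℝ) 1) : ContinuousOn (greenKernel k φ x) (Ioo (-1) 1) :=
  (hφ.continuousOn_greenKernel_left hx).congr fun y _ => greenKernel_symm x y

lemma integrableOn_mul_left (hφ : IsExpSolution f k φ) (hf : ∀ x ∈ Ioo (-1 : ℝ) 1, 0 < f x)
    (hk : 0 < k) (hu : ContinuousOn u (Ioo (-1) 1)) (hC : ∀ x ∈ Ioo (-1 : ℝ) 1, |u x| ≤ C)
    {x : ℝ} (hx : x ∈ Ioo (-1 : ℝ) 1) :
    IntervalIntegrable (fun y => φ y * u y) volume (-1) x ∧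
      |∫ y in (-1)..x, φ y * u y| ≤ 2 * C * φ x := by
  have hC0 : 0 ≤ C := (abs_nonneg _).trans (hC x hx)
  have hsub : Ioo (-1) x ⊆ Ioo (-1 : ℝ) 1 := Ioo_subset_Ioo_right hx.2.le
  have hbd : ∀ y ∈ Ioo (-1) x, ‖φ y * u y‖ ≤ φ x * C := fun y hy => by
    rw [Real.norm_eq_abs, abs_mul, abs_of_pos (hφ.pos y (hsub hy))]
    exact mul_le_mul (hφ.monotoneOn hf hk (hsub hy) hx hy.2.le) (hC y (hsub hy)) (abs_nonneg _)
      (hφ.pos x hx).le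
  constructor
  · rw [intervalIntegrable_iff_integrableOn_Ioo_of_le hx.1.le]
    refine IntegrableOn.of_bound (by simp)
      (((hφ.continuousOn.mul hu).mono hsub).aestronglyMeasurable measurableSet_Ioo) (φ x * C) ?_
    exact (ae_restrict_iff' measurableSet_Ioo).2 (ae_of_all _ hbd)
  · rw [integral_of_le hx.1.le, integral_Ioc_eq_integral_Ioo]
    refine (norm_setIntegral_le_of_norm_le_const (by simp) hbd).trans ?_
    rw [Real.volume_real_Ioo_of_le hx.1.le]
    have := mul_nonneg (hφ.pos x hx).le hC0
    nlinarith [hx.2]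

lemma integrableOn_mul_right (hφ : IsExpSolution f k φ) (hf : ∀ x ∈ Ioo (-1 : ℝ) 1, 0 < f x)
    (hk : 0 < k) (hu : ContinuousOn u (Ioo (-1) 1)) (hC : ∀ x ∈ Ioo (-1 : ℝ) 1, |u x| ≤ C)
    {x : ℝ} (hx : x ∈ Ioo (-1 : ℝ) 1) :
    IntervalIntegrable (fun y => (φ y)⁻¹ * u y) volume x 1 ∧
      |∫ y in x..1, (φ y)⁻¹ * u y| ≤ 2 * C * (φ x)⁻¹ := by
  have hC0 : 0 ≤ C := (abs_nonneg _).trans (hC x hx)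
  have hsub : Ioo x 1 ⊆ Ioo (-1 : ℝ) 1 := Ioo_subset_Ioo_left hx.1.le
  have hbd : ∀ y ∈ Ioo x 1, ‖(φ y)⁻¹ * u y‖ ≤ (φ x)⁻¹ * C := fun y hy => by
    have hφy := hφ.pos y (hsub hy)
    have hφx := hφ.pos x hx
    rw [Real.norm_eq_abs, abs_mul, abs_of_pos (inv_pos.2 hφy)]
    exact mul_le_mul (inv_anti₀ hφx (hφ.monotoneOn hf hk hx (hsub hy) hy.1.le))
      (hC y (hsub hy)) (abs_nonneg _) (inv_pos.2 hφx).le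
  constructor
  · rw [intervalIntegrable_iff_integrableOn_Ioo_of_le hx.2.le]
    refine IntegrableOn.of_bound (by simp)
      (((hφ.continuousOn_inv.mul hu).mono hsub).aestronglyMeasurable measurableSet_Ioo)
      ((φ x)⁻¹ * C) ?_
    exact (ae_restrict_iff' measurableSet_Ioo).2 (ae_of_all _ hbd)
  · rw [integral_of_le hx.2.le, integral_Ioc_eq_integral_Ioo]
    refine (norm_setIntegral_le_of_norm_le_const (by simp) hbd).trans ?_
    rw [Real.volume_real_Ioo_of_le hx.2.le]
    have := mul_nonneg (inv_pos.2 (hφ.pos x hx)).le hC0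
    nlinarith [hx.1]

lemma integrableOn_greenKernel_mul (hφ : IsExpSolution f k φ) (hk : 0 < k)
    (hu : ContinuousOn u (Ioo (-1) 1)) (hC : ∀ x ∈ Ioo (-1 : ℝ) 1, |u x| ≤ C)
    {x : ℝ} (hx : x ∈ Ioo (-1 : ℝ) 1) :
    IntegrableOn (fun y => greenKernel k φ x y * u y) (Ioo (-1) 1) := by
  refine IntegrableOn.of_bound (by simp)
    (((hφ.continuousOn_greenKernel_right hx).mul hu).aestronglyMeasurable measurableSet_Ioo)
    ((2 * k)⁻¹ * C) ?_
  refine (ae_restrict_iff' measurableSet_Ioo).2 (ae_of_all _ fun y hy => ?_)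
  rw [norm_mul, Real.norm_of_nonneg (hφ.greenKernel_nonneg hk hx hy)]
  exact mul_le_mul (hφ.greenKernel_le_const hk hx hy) (hC y hy) (abs_nonneg _) (by positivity)

lemma greenPotential_eq (hφ : IsExpSolution f k φ) (hf : ∀ x ∈ Ioo (-1 : ℝ) 1, 0 < f x)
    (hk : 0 < k) (hu : ContinuousOn u (Ioo (-1) 1)) (hC : ∀ x ∈ Ioo (-1 : ℝ) 1, |u x| ≤ C)
    {x : ℝ} (hx : x ∈ Ioo (-1 : ℝ) 1) :
    greenPotential k φ u x = (2 * k)⁻¹ * ((φ x)⁻¹ * (∫ y in (-1)..x, φ y * u y) +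
      φ x * ∫ y in x..1, (φ y)⁻¹ * u y) := by
  have hint := hφ.integrableOn_greenKernel_mul hk hu hC hx
  have hsubl : Ioo (-1) x ⊆ Ioo (-1 : ℝ) 1 := Ioo_subset_Ioo_right hx.2.le
  have hsubr : Ioo x 1 ⊆ Ioo (-1 : ℝ) 1 := Ioo_subset_Ioo_left hx.1.le
  have hl : ∫ y in (-1)..x, greenKernel k φ x y * u y =
      (2 * k)⁻¹ * ((φ x)⁻¹ * ∫ y in (-1)..x, φ y * u y) := by
    rw [← intervalIntegral.integral_const_mul, ← intervalIntegral.integral_const_mul,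
      integral_of_le hx.1.le, integral_of_le hx.1.le, integral_Ioc_eq_integral_Ioo,
      integral_Ioc_eq_integral_Ioo]
    refine setIntegral_congr_fun measurableSet_Ioo fun y hy => ?_
    simp only [hφ.greenKernel_of_ge hx (hsubl hy) (hφ.monotoneOn hf hk (hsubl hy) hx hy.2.le)]
    ring
  have hr : ∫ y in x..1, greenKernel k φ x y * u y =
      (2 * k)⁻¹ * (φ x * ∫ y in x..1, (φ y)⁻¹ * u y) := by
    rw [← intervalIntegral.integral_const_mul, ← intervalIntegral.integral_const_mul,
      integral_of_le hx.2.le, integral_of_le hx.2.le, integral_Ioc_eq_integral_Ioo,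
      integral_Ioc_eq_integral_Ioo]
    refine setIntegral_congr_fun measurableSet_Ioo fun y hy => ?_
    simp only [hφ.greenKernel_of_le hx (hsubr hy) (hφ.monotoneOn hf hk hx (hsubr hy) hy.1.le)]
    ring
  rw [mul_add, ← hl, ← hr, integral_add_adjacent_intervals, greenPotential,
    ← integral_Ioc_eq_integral_Ioo, integral_of_le (by norm_num)]
  · exact (intervalIntegrable_iff_integrableOn_Ioo_of_le hx.1.le).2 (hint.mono_set hsubl)
  · exact (intervalIntegrable_iff_integrableOn_Ioo_of_le hx.2.le).2 (hint.mono_set hsubr)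

lemma hasDerivAt_inv (hφ : IsExpSolution f k φ) {x : ℝ} (hx : x ∈ Ioo (-1 : ℝ) 1) :
    HasDerivAt (fun y => (φ y)⁻¹) (-(k * (φ x)⁻¹ / f x)) x := by
  have := hφ.pos x hx
  refine ((hφ.hasDerivAt x hx).fun_inv this.ne').congr_deriv ?_
  field_simp

lemma hasDerivAt_integral_left (hφ : IsExpSolution f k φ) (hf : ∀ x ∈ Ioo (-1 : ℝ) 1, 0 < f x)
    (hk : 0 < k) (hu : ContinuousOn u (Ioo (-1) 1)) (hC : ∀ x ∈ Ioo (-1 : ℝ) 1, |u x| ≤ C)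
    {x : ℝ} (hx : x ∈ Ioo (-1 : ℝ) 1) :
    HasDerivAt (fun x => ∫ y in (-1)..x, φ y * u y) (φ x * u x) x :=
  have hc := hφ.continuousOn.mul hu
  integral_hasDerivAt_right (hφ.integrableOn_mul_left hf hk hu hC hx).1
    (hc.stronglyMeasurableAtFilter isOpen_Ioo x hx) (hc.continuousAt (isOpen_Ioo.mem_nhds hx))

lemma hasDerivAt_integral_right (hφ : IsExpSolution f k φ) (hf : ∀ x ∈ Ioo (-1 : ℝ) 1, 0 < f x)
    (hk : 0 < k) (hu : ContinuousOn u (Ioo (-1) 1)) (hC : ∀ x ∈ Ioo (-1 : ℝ) 1, |u x| ≤ C)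
    {x : ℝ} (hx : x ∈ Ioo (-1 : ℝ) 1) :
    HasDerivAt (fun x => ∫ y in x..1, (φ y)⁻¹ * u y) (-((φ x)⁻¹ * u x)) x :=
  have hc := hφ.continuousOn_inv.mul hu
  integral_hasDerivAt_left (hφ.integrableOn_mul_right hf hk hu hC hx).1
    (hc.stronglyMeasurableAtFilter isOpen_Ioo x hx) (hc.continuousAt (isOpen_Ioo.mem_nhds hx))

lemma hasDerivAt_greenPotential (hφ : IsExpSolution f k φ)
    (hf : ∀ x ∈ Ioo (-1 : ℝ) 1, 0 < f x) (hk : 0 < k) (hu : ContinuousOn u (Ioo (-1) 1))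
    (hC : ∀ x ∈ Ioo (-1 : ℝ) 1, |u x| ≤ C) {x : ℝ} (hx : x ∈ Ioo (-1 : ℝ) 1) :
    HasDerivAt (greenPotential k φ u) (greenFlux φ u x / f x) x := by
  have h := ((((hφ.hasDerivAt_inv hx).mul (hφ.hasDerivAt_integral_left hf hk hu hC hx)).add
    ((hφ.hasDerivAt x hx).mul (hφ.hasDerivAt_integral_right hf hk hu hC hx))).const_mul
      (2 * k)⁻¹).congr_of_eventuallyEq (f₁ := greenPotential k φ u) ?_
  · refine h.congr_deriv ?_
    have := hφ.pos x hx
    have := hf x hx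
    rw [greenFlux]
    field_simp
    ring
  · filter_upwards [isOpen_Ioo.mem_nhds hx] with y hy
    exact hφ.greenPotential_eq hf hk hu hC hy

lemma hasDerivAt_greenFlux (hφ : IsExpSolution f k φ)
    (hf : ∀ x ∈ Ioo (-1 : ℝ) 1, 0 < f x) (hk : 0 < k) (hu : ContinuousOn u (Ioo (-1) 1))
    (hC : ∀ x ∈ Ioo (-1 : ℝ) 1, |u x| ≤ C) {x : ℝ} (hx : x ∈ Ioo (-1 : ℝ) 1) :
    HasDerivAt (greenFlux φ u) (k ^ 2 / f x * greenPotential k φ u x - u x) x := by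
  have h := (((hφ.hasDerivAt x hx).mul (hφ.hasDerivAt_integral_right hf hk hu hC hx)).sub
    ((hφ.hasDerivAt_inv hx).mul (hφ.hasDerivAt_integral_left hf hk hu hC hx))).const_mul 2⁻¹
  refine HasDerivAt.congr_deriv (f := greenFlux φ u) h ?_
  have := hφ.pos x hx
  have := hf x hx
  rw [hφ.greenPotential_eq hf hk hu hC hx]
  field_simp
  ring

lemma abs_greenFlux_le (hφ : IsExpSolution f k φ) (hf : ∀ x ∈ Ioo (-1 : ℝ) 1, 0 < f x)
    (hk : 0 < k) (hu : ContinuousOn u (Ioo (-1) 1)) (hC : ∀ x ∈ Ioo (-1 : ℝ) 1, |u x| ≤ C)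
    {x : ℝ} (hx : x ∈ Ioo (-1 : ℝ) 1) : |greenFlux φ u x| ≤ 2 * C := by
  have h1 := (hφ.integrableOn_mul_left hf hk hu hC hx).2
  have h2 := (hφ.integrableOn_mul_right hf hk hu hC hx).2
  have h0 := hφ.pos x hx
  rw [greenFlux, abs_mul, abs_of_pos (by norm_num : (0 : ℝ) < 2⁻¹)]
  have h3 : |φ x * ∫ y in x..1, (φ y)⁻¹ * u y| ≤ 2 * C := by
    rw [abs_mul, abs_of_pos h0]
    calc _ ≤ φ x * (2 * C * (φ x)⁻¹) := by gcongr
      _ = 2 * C := by field_simp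
  have h4 : |(φ x)⁻¹ * ∫ y in (-1)..x, φ y * u y| ≤ 2 * C := by
    rw [abs_mul, abs_of_pos (inv_pos.2 h0)]
    calc _ ≤ (φ x)⁻¹ * (2 * C * φ x) := by gcongr
      _ = 2 * C := by field_simp
  linarith [abs_sub (φ x * ∫ y in x..1, (φ y)⁻¹ * u y) ((φ x)⁻¹ * ∫ y in (-1)..x, φ y * u y)]

lemma tendsto_greenPotential (hφ : IsExpSolution f k φ) (hk : 0 < k)
    (hu : ContinuousOn u (Ioo (-1) 1)) (hC : ∀ x ∈ Ioo (-1 : ℝ) 1, |u x| ≤ C) {l : Filter ℝ}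
    [l.IsCountablyGenerated] (hl : ∀ᶠ x in l, x ∈ Ioo (-1 : ℝ) 1)
    (hG : ∀ y ∈ Ioo (-1 : ℝ) 1, Tendsto (fun x => greenKernel k φ x y) l (nhds 0)) :
    Tendsto (greenPotential k φ u) l (nhds 0) := by
  have h := tendsto_integral_filter_of_dominated_convergence (μ := volume.restrict (Ioo (-1 : ℝ) 1))
    (l := l) (F := fun x y => greenKernel k φ x y * u y) (f := fun _ => 0)
    (fun _ => (2 * k)⁻¹ * C) ?_ ?_ (integrable_const _) ?_
  · simpa using! h
  · filter_upwards [hl] with x hx using (hφ.integrableOn_greenKernel_mul hk hu hC hx).1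
  · filter_upwards [hl] with x hx
    refine (ae_restrict_iff' measurableSet_Ioo).2 (ae_of_all _ fun y hy => ?_)
    rw [norm_mul, Real.norm_of_nonneg (hφ.greenKernel_nonneg hk hx hy)]
    exact mul_le_mul (hφ.greenKernel_le_const hk hx hy) (hC y hy) (abs_nonneg _) (by positivity)
  · refine (ae_restrict_iff' measurableSet_Ioo).2 (ae_of_all _ fun y hy => ?_)
    simpa using (hG y hy).mul_const (u y)

lemma tendsto_greenPotential_one (hφ : IsExpSolution f k φ) (hk : 0 < k)
    (hu : ContinuousOn u (Ioo (-1) 1)) (hC : ∀ x ∈ Ioo (-1 : ℝ) 1, |u x| ≤ C) :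
    Tendsto (greenPotential k φ u) (nhdsWithin 1 (Iio 1)) (nhds 0) := by
  have hI : ∀ᶠ x in nhdsWithin (1 : ℝ) (Iio 1), x ∈ Ioo (-1 : ℝ) 1 :=
    Ioo_mem_nhdsLT (by norm_num)
  refine hφ.tendsto_greenPotential hk hu hC hI fun y hy => ?_
  have h0 : Tendsto (fun x => (2 * k)⁻¹ * ((φ x)⁻¹ * φ y)) (nhdsWithin 1 (Iio 1)) (nhds 0) := by
    simpa using ((tendsto_inv_atTop_zero.comp hφ.tendsto_one).mul_const (φ y)).const_mul (2 * k)⁻¹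
  refine tendsto_of_tendsto_of_tendsto_of_le_of_le' tendsto_const_nhds h0 ?_ ?_
  · filter_upwards [hI] with x hx using hφ.greenKernel_nonneg hk hx hy
  · filter_upwards [hI] with x hx
    refine (hφ.greenKernel_le hk hx hy).trans ?_
    gcongr
    exact min_le_right _ _

lemma tendsto_greenPotential_neg_one (hφ : IsExpSolution f k φ) (hk : 0 < k)
    (hu : ContinuousOn u (Ioo (-1) 1)) (hC : ∀ x ∈ Ioo (-1 : ℝ) 1, |u x| ≤ C) :
    Tendsto (greenPotential k φ u) (nhdsWithin (-1) (Ioi (-1))) (nhds 0) := by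
  have hI : ∀ᶠ x in nhdsWithin (-1 : ℝ) (Ioi (-1)), x ∈ Ioo (-1 : ℝ) 1 :=
    Ioo_mem_nhdsGT (by norm_num)
  refine hφ.tendsto_greenPotential hk hu hC hI fun y hy => ?_
  have h0 : Tendsto (fun x => (2 * k)⁻¹ * (φ x * (φ y)⁻¹)) (nhdsWithin (-1) (Ioi (-1)))
      (nhds 0) := by
    simpa using (hφ.tendsto_neg_one.mul_const (φ y)⁻¹).const_mul (2 * k)⁻¹
  refine tendsto_of_tendsto_of_tendsto_of_le_of_le' tendsto_const_nhds h0 ?_ ?_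
  · filter_upwards [hI] with x hx using hφ.greenKernel_nonneg hk hx hy
  · filter_upwards [hI] with x hx
    refine (hφ.greenKernel_le hk hx hy).trans ?_
    gcongr
    exact min_le_left _ _

end IsExpSolution

end Green

lemma exists_eq_const_of_hasDerivAt_zero {a b : ℝ} {g : ℝ → ℝ}
    (hg : ∀ x ∈ Ioo a b, HasDerivAt g 0 x) : ∃ c, ∀ x ∈ Ioo a b, g x = c :=
  isOpen_Ioo.exists_is_const_of_deriv_eq_zero isPreconnected_Ioo
    (fun x hx => (hg x hx).differentiableAt.differentiableWithinAt) fun x hx => (hg x hx).deriv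

lemma contDiffOn_succ_of_hasDerivAt {s : Set ℝ} (hs : IsOpen s) {g g' : ℝ → ℝ} {n : ℕ}
    (hg : ∀ x ∈ s, HasDerivAt g (g' x) x) (hg' : ContDiffOn ℝ n g' s) :
    ContDiffOn ℝ (n + 1 : ℕ) g s := by
  push_cast
  rw [contDiffOn_succ_iff_deriv_of_isOpen hs]
  exact ⟨fun x hx => (hg x hx).differentiableAt.differentiableWithinAt, by simp,
    hg'.congr fun x hx => (hg x hx).deriv⟩

section Eigenfunctions

variable {f φ u : ℝ → ℝ} {k C lam : ℝ}

namespace IsExpSolution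

/-- The equation `L_k h = 0` has no nonzero solution vanishing at `±1`. -/
lemma eq_zero_of_homogeneous (hφ : IsExpSolution f k φ) (hf : ∀ x ∈ Ioo (-1 : ℝ) 1, 0 < f x)
    (hk : 0 < k) {h p : ℝ → ℝ} (hh : ∀ x ∈ Ioo (-1 : ℝ) 1, HasDerivAt h (p x / f x) x)
    (hp : ∀ x ∈ Ioo (-1 : ℝ) 1, HasDerivAt p (k ^ 2 / f x * h x) x)
    (h1 : Tendsto h (nhdsWithin 1 (Iio 1)) (nhds 0))
    (hn1 : Tendsto h (nhdsWithin (-1) (Ioi (-1))) (nhds 0)) :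
    ∀ x ∈ Ioo (-1 : ℝ) 1, h x = 0 := by
  obtain ⟨c, hc⟩ := exists_eq_const_of_hasDerivAt_zero
    (g := fun x => (p x + k * h x) * (φ x)⁻¹) fun x hx => by
      refine (((hp x hx).add ((hh x hx).const_mul k)).mul (hφ.hasDerivAt_inv hx)).congr_deriv ?_
      have := hf x hx
      simp only [Pi.add_apply]
      field_simp
      ring
  obtain ⟨d, hd⟩ := exists_eq_const_of_hasDerivAt_zero
    (g := fun x => (p x - k * h x) * φ x) fun x hx => by
      refine (((hp x hx).sub ((hh x hx).const_mul k)).mul (hφ.hasDerivAt x hx)).congr_deriv ?_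
      have := hf x hx
      simp only [Pi.sub_apply]
      field_simp
      ring
  have key : ∀ x ∈ Ioo (-1 : ℝ) 1, 2 * k * h x = c * φ x - d * (φ x)⁻¹ := by
    intro x hx
    have := hφ.pos x hx
    rw [← hc x hx, ← hd x hx]
    field_simp
    ring
  have hc0 : c = 0 := by
    have hinv := tendsto_inv_atTop_zero.comp hφ.tendsto_one
    have hlim : Tendsto (fun x => (2 * k * h x + d * (φ x)⁻¹) * (φ x)⁻¹)
        (nhdsWithin 1 (Iio 1)) (nhds 0) := by
      simpa [Function.comp_def] using ((h1.const_mul (2 * k)).add (hinv.const_mul d)).mul hinv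
    refine tendsto_nhds_unique (tendsto_const_nhds.congr' ?_) hlim
    filter_upwards [Ioo_mem_nhdsLT (show (-1 : ℝ) < 1 by norm_num)] with x hx
    have := hφ.pos x hx
    rw [key x hx]
    field_simp
    ring
  have hd0 : d = 0 := by
    have hlim : Tendsto (fun x => (c * φ x - 2 * k * h x) * φ x)
        (nhdsWithin (-1) (Ioi (-1))) (nhds 0) := by
      simpa using ((hφ.tendsto_neg_one.const_mul c).sub (hn1.const_mul (2 * k))).mul
        hφ.tendsto_neg_one
    refine tendsto_nhds_unique (tendsto_const_nhds.congr' ?_) hlim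
    filter_upwards [Ioo_mem_nhdsGT (show (-1 : ℝ) < 1 by norm_num)] with x hx
    have := hφ.pos x hx
    rw [key x hx]
    field_simp
    ring
  intro x hx
  have := key x hx
  rw [hc0, hd0] at this
  have h2k : 2 * k ≠ 0 := by positivity
  simpa [h2k] using this

/-- An eigenfunction of `L_k` is an eigenfunction of the Green operator. -/
lemma exists_eq_greenPotential (hf : IsProfile f) {k : ℕ} (hk : 1 ≤ k)
    (hφ : IsExpSolution f k φ) (h : InSpec f k lam) :
    ∃ u C, ContinuousOn u (Ioo (-1) 1) ∧ (∀ x ∈ Ioo (-1 : ℝ) 1, |u x| ≤ C) ∧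
      (∃ x ∈ Ioo (-1 : ℝ) 1, u x ≠ 0) ∧
      ∀ x ∈ Ioo (-1 : ℝ) 1, u x = lam * greenPotential k φ u x := by
  obtain ⟨u, hcont, hsm, hne, hbdry, hode⟩ := h
  obtain ⟨hun, hu1⟩ := hbdry hk
  obtain ⟨C, hC⟩ := isCompact_Icc.exists_bound_of_continuousOn hcont
  have hC' : ∀ x ∈ Ioo (-1 : ℝ) 1, |u x| ≤ C := fun x hx => hC x (Ioo_subset_Icc_self hx)
  have hu : ContinuousOn u (Ioo (-1) 1) := hsm.continuousOn
  have hk0 : (0 : ℝ) < k := by exact_mod_cast hk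
  refine ⟨u, C, hu, hC', hne, ?_⟩
  have hdu : ContDiffOn ℝ (⊤ : ℕ∞) (deriv u) (Ioo (-1) 1) :=
    ((contDiffOn_infty_iff_deriv_of_isOpen isOpen_Ioo).1 hsm).2
  have hu' : ∀ x ∈ Ioo (-1 : ℝ) 1, HasDerivAt u (deriv u x) x := fun x hx =>
    ((hsm.differentiableOn (by simp)).differentiableAt (isOpen_Ioo.mem_nhds hx)).hasDerivAt
  have hp' : ∀ x ∈ Ioo (-1 : ℝ) 1, HasDerivAt (fun y => f y * deriv u y)
      (k ^ 2 / f x * u x - lam * u x) x := fun x hx => by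
    have h1 := (((hf.smoothOn.mul hdu).differentiableOn (by simp)).differentiableAt
      (isOpen_Ioo.mem_nhds hx)).hasDerivAt
    refine h1.congr_deriv ?_
    have := hode x hx
    change deriv (fun y => f y * deriv u y) x = _
    linarith
  have hzero := hφ.eq_zero_of_homogeneous hf.pos hk0
    (h := fun x => u x - lam * greenPotential k φ u x)
    (p := fun x => f x * deriv u x - lam * greenFlux φ u x) ?_ ?_ ?_ ?_
  · exact fun x hx => sub_eq_zero.1 (hzero x hx)
  · intro x hx
    refine ((hu' x hx).sub ((hφ.hasDerivAt_greenPotential hf.pos hk0 hu hC' hx).const_mul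
      lam)).congr_deriv ?_
    have := hf.pos x hx
    field_simp
  · intro x hx
    refine ((hp' x hx).sub ((hφ.hasDerivAt_greenFlux hf.pos hk0 hu hC' hx).const_mul
      lam)).congr_deriv ?_
    ring
  · have h1 : Tendsto u (nhdsWithin 1 (Iio 1)) (nhds 0) := by
      have := ((hcont 1 (by simp)).mono Ioo_subset_Icc_self).tendsto
      rwa [hu1, nhdsWithin_Ioo_eq_nhdsLT (by norm_num)] at this
    simpa using h1.sub ((hφ.tendsto_greenPotential_one hk0 hu hC').const_mul lam)
  · have h1 : Tendsto u (nhdsWithin (-1) (Ioi (-1))) (nhds 0) := by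
      have := ((hcont (-1) (by simp)).mono Ioo_subset_Icc_self).tendsto
      rwa [hun, nhdsWithin_Ioo_eq_nhdsGT (by norm_num)] at this
    simpa using h1.sub ((hφ.tendsto_greenPotential_neg_one hk0 hu hC').const_mul lam)

lemma contDiffOn_greenPotential (hf : IsProfile f) (hφ : IsExpSolution f k φ) (hk : 0 < k)
    (hu : ContinuousOn u (Ioo (-1) 1)) (hC : ∀ x ∈ Ioo (-1 : ℝ) 1, |u x| ≤ C)
    (heq : ∀ x ∈ Ioo (-1 : ℝ) 1, u x = lam * greenPotential k φ u x) (n : ℕ) :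
    ContDiffOn ℝ n (greenPotential k φ u) (Ioo (-1) 1) ∧
      ContDiffOn ℝ n (greenFlux φ u) (Ioo (-1) 1) := by
  have hR := fun x hx => hφ.hasDerivAt_greenPotential hf.pos hk hu hC (x := x) hx
  have hS := fun x hx => hφ.hasDerivAt_greenFlux hf.pos hk hu hC (x := x) hx
  have hfn : ∀ n : ℕ, ContDiffOn ℝ n f (Ioo (-1) 1) := contDiffOn_infty.1 hf.smoothOn
  have hf0 : ∀ x ∈ Ioo (-1 : ℝ) 1, f x ≠ 0 := fun x hx => (hf.pos x hx).ne'
  induction n with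
  | zero =>
    simp only [Nat.cast_zero, contDiffOn_zero]
    exact ⟨HasDerivAt.continuousOn hR, HasDerivAt.continuousOn hS⟩
  | succ n ih =>
    refine ⟨contDiffOn_succ_of_hasDerivAt isOpen_Ioo hR (ih.2.div (hfn n) hf0),
      contDiffOn_succ_of_hasDerivAt isOpen_Ioo hS ?_⟩
    exact ((contDiffOn_const.div (hfn n) hf0).mul ih.1).sub
      ((contDiffOn_const.mul ih.1).congr heq)

/-- An eigenfunction of the Green operator is an eigenfunction of `L_k`. -/
lemma inSpec_of_eq_greenPotential (hf : IsProfile f) {k : ℕ} (hk : 1 ≤ k)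
    (hφ : IsExpSolution f k φ) (hu : ContinuousOn u (Ioo (-1) 1))
    (hC : ∀ x ∈ Ioo (-1 : ℝ) 1, |u x| ≤ C) (hne : ∃ x ∈ Ioo (-1 : ℝ) 1, u x ≠ 0)
    (heq : ∀ x ∈ Ioo (-1 : ℝ) 1, u x = lam * greenPotential k φ u x) : InSpec f k lam := by
  have hk0 : (0 : ℝ) < k := by exact_mod_cast hk
  have heq' : EqOn ((Ioo (-1 : ℝ) 1).indicator u) (fun x => lam * greenPotential k φ u x)
      (Ioo (-1) 1) := fun x hx => by rw [indicator_of_mem hx, heq x hx]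
  have hend : (Ioo (-1 : ℝ) 1).indicator u (-1) = 0 ∧ (Ioo (-1 : ℝ) 1).indicator u 1 = 0 := by
    simp
  have hder : ∀ x ∈ Ioo (-1 : ℝ) 1, HasDerivAt ((Ioo (-1 : ℝ) 1).indicator u)
      (lam * (greenFlux φ u x / f x)) x := fun x hx =>
    ((hφ.hasDerivAt_greenPotential hf.pos hk0 hu hC hx).const_mul lam).congr_of_eventuallyEq
      (heq'.eventuallyEq_of_mem (isOpen_Ioo.mem_nhds hx))
  refine ⟨(Ioo (-1) 1).indicator u, ?_, ?_, ?_, fun _ => hend, ?_⟩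
  · intro x hx
    rcases eq_or_lt_of_le hx.1 with rfl | hx1
    · have h : ContinuousWithinAt ((Ioo (-1 : ℝ) 1).indicator u) (Ioi (-1)) (-1) := by
        rw [ContinuousWithinAt, hend.1]
        have := (hφ.tendsto_greenPotential_neg_one hk0 hu hC).const_mul lam
        rw [mul_zero] at this
        exact this.congr' (heq'.symm.eventuallyEq_of_mem (Ioo_mem_nhdsGT (by norm_num)))
      exact (continuousWithinAt_insert_self.2 h).mono fun y hy => by
        rw [Ioi_insert]; exact hy.1
    rcases eq_or_lt_of_le hx.2 with rfl | hx2
    · have h : ContinuousWithinAt ((Ioo (-1 : ℝ) 1).indicator u) (Iio 1) 1 := by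
        rw [ContinuousWithinAt, hend.2]
        have := (hφ.tendsto_greenPotential_one hk0 hu hC).const_mul lam
        rw [mul_zero] at this
        exact this.congr' (heq'.symm.eventuallyEq_of_mem (Ioo_mem_nhdsLT (by norm_num)))
      exact (continuousWithinAt_insert_self.2 h).mono fun y hy => by
        rw [Iio_insert]; exact hy.2
    · exact (hder x ⟨hx1, hx2⟩).continuousAt.continuousWithinAt
  · refine contDiffOn_infty.2 fun n => ContDiffOn.congr ?_ heq'
    exact contDiffOn_const.mul (hφ.contDiffOn_greenPotential hf hk0 hu hC heq n).1
  · obtain ⟨x, hx, hux⟩ := hne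
    exact ⟨x, hx, by rwa [indicator_of_mem hx]⟩
  · intro x hx
    have hflux : (fun y => f y * deriv ((Ioo (-1 : ℝ) 1).indicator u) y) =ᶠ[nhds x]
        fun y => lam * greenFlux φ u y := by
      filter_upwards [isOpen_Ioo.mem_nhds hx] with y hy
      have := hf.pos y hy
      rw [(hder y hy).deriv]
      field_simp
    rw [hflux.deriv_eq,
      ((hφ.hasDerivAt_greenFlux hf.pos hk0 hu hC hx).const_mul lam).deriv, heq' hx, heq x hx]
    ring

/-- The eigenvalues of the Green operator are simple. -/
lemma exists_eq_mul_of_eq_greenPotential (hf : IsProfile f) (hφ : IsExpSolution f k φ)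
    (hk : 0 < k) {v : ℝ → ℝ} {D : ℝ} (hu : ContinuousOn u (Ioo (-1) 1))
    (hC : ∀ x ∈ Ioo (-1 : ℝ) 1, |u x| ≤ C) (hne : ∃ x ∈ Ioo (-1 : ℝ) 1, u x ≠ 0)
    (hueq : ∀ x ∈ Ioo (-1 : ℝ) 1, u x = lam * greenPotential k φ u x)
    (hv : ContinuousOn v (Ioo (-1) 1)) (hD : ∀ x ∈ Ioo (-1 : ℝ) 1, |v x| ≤ D)
    (hveq : ∀ x ∈ Ioo (-1 : ℝ) 1, v x = lam * greenPotential k φ v x) :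
    ∃ c, ∀ x ∈ Ioo (-1 : ℝ) 1, v x = c * u x := by
  have hode : ∀ {w : ℝ → ℝ} {B : ℝ}, ContinuousOn w (Ioo (-1) 1) →
      (∀ x ∈ Ioo (-1 : ℝ) 1, |w x| ≤ B) →
      (∀ x ∈ Ioo (-1 : ℝ) 1, w x = lam * greenPotential k φ w x) → ∀ x ∈ Ioo (-1 : ℝ) 1,
      HasDerivAt w (lam * greenFlux φ w x / f x) x ∧
      HasDerivAt (fun y => lam * greenFlux φ w y) ((k ^ 2 / f x - lam) * w x) x := by
    intro w B hw hB hweq x hx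
    constructor
    · refine (((hφ.hasDerivAt_greenPotential hf.pos hk hw hB hx).const_mul
        lam).congr_of_eventuallyEq ?_).congr_deriv (by ring)
      filter_upwards [isOpen_Ioo.mem_nhds hx] with y hy using hweq y hy
    · refine ((hφ.hasDerivAt_greenFlux hf.pos hk hw hB hx).const_mul lam).congr_deriv ?_
      linear_combination (-k ^ 2 / f x) * hweq x hx
  have hlim : ∀ {w : ℝ → ℝ} {B : ℝ}, ContinuousOn w (Ioo (-1) 1) →
      (∀ x ∈ Ioo (-1 : ℝ) 1, |w x| ≤ B) →
      (∀ x ∈ Ioo (-1 : ℝ) 1, w x = lam * greenPotential k φ w x) →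
      Tendsto w (nhdsWithin 1 (Iio 1)) (nhds 0) := by
    intro w B hw hB hweq
    have := (hφ.tendsto_greenPotential_one hk hw hB).const_mul lam
    rw [mul_zero] at this
    refine this.congr' ?_
    filter_upwards [Ioo_mem_nhdsLT (show (-1 : ℝ) < 1 by norm_num)] with x hx
    exact (hweq x hx).symm
  have hbdd : ∀ {w : ℝ → ℝ} {B : ℝ}, ContinuousOn w (Ioo (-1) 1) →
      (∀ x ∈ Ioo (-1 : ℝ) 1, |w x| ≤ B) → IsBoundedUnder (· ≤ ·) (nhdsWithin (1 : ℝ) (Iio 1))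
      (fun x => ‖lam * greenFlux φ w x‖) := by
    intro w B hw hB
    refine ⟨|lam| * (2 * B), eventually_map.2 ?_⟩
    filter_upwards [Ioo_mem_nhdsLT (show (-1 : ℝ) < 1 by norm_num)] with x hx
    rw [norm_mul]
    exact mul_le_mul_of_nonneg_left (hφ.abs_greenFlux_le hf.pos hk hw hB hx) (abs_nonneg _)
  obtain ⟨W, hW⟩ := exists_eq_const_of_hasDerivAt_zero
    (g := fun x => u x * (lam * greenFlux φ v x) - v x * (lam * greenFlux φ u x))
    fun x hx => by
      obtain ⟨hu1, hu2⟩ := hode hu hC hueq x hx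
      obtain ⟨hv1, hv2⟩ := hode hv hD hveq x hx
      refine ((hu1.mul hv2).sub (hv1.mul hu2)).congr_deriv ?_
      ring
  have hW0 : W = 0 := by
    have h := ((hlim hu hC hueq).zero_mul_isBoundedUnder_le (hbdd hv hD)).sub
      ((hlim hv hD hveq).zero_mul_isBoundedUnder_le (hbdd hu hC))
    rw [sub_zero] at h
    refine tendsto_nhds_unique (tendsto_const_nhds.congr' ?_) h
    filter_upwards [Ioo_mem_nhdsLT (show (-1 : ℝ) < 1 by norm_num)] with x hx
    exact (hW x hx).symm
  obtain ⟨x₀, hx₀, hux₀⟩ := hne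
  refine ⟨v x₀ / u x₀, fun x hx => sub_eq_zero.1 ?_⟩
  have hfc := hf.smoothOn.continuousOn
  refine eqOn_zero_of_linear_system (f := f) (q := fun x => k ^ 2 / f x - lam)
    (w := fun x => v x - v x₀ / u x₀ * u x)
    (p := fun x => lam * greenFlux φ v x - v x₀ / u x₀ * (lam * greenFlux φ u x))
    hfc hf.pos ((continuousOn_const.div hfc fun x hx => (hf.pos x hx).ne').sub continuousOn_const)
    (fun y hy => ?_) (fun y hy => ?_) hx₀ ?_ ?_ hx
  · refine ((hode hv hD hveq y hy).1.sub
      ((hode hu hC hueq y hy).1.const_mul (v x₀ / u x₀))).congr_deriv ?_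
    ring
  · refine ((hode hv hD hveq y hy).2.sub
      ((hode hu hC hueq y hy).2.const_mul (v x₀ / u x₀))).congr_deriv ?_
    ring
  · field_simp
    ring
  · have := hW x₀ hx₀
    rw [hW0] at this
    field_simp
    linear_combination this

end IsExpSolution

end Eigenfunctions

section FeatureMap

variable {f φ : ℝ → ℝ} {k : ℝ}

/-- `Φ` is a total family of vectors whose Gram kernel on `(-1,1)` is the Green kernel. -/
structure IsGreenFeature {F : Type*} [NormedAddCommGroup F] [InnerProductSpace ℝ F]
    (k : ℝ) (φ : ℝ → ℝ) (Φ : ℝ → F) : Prop where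
  inner_eq : ∀ x ∈ Ioo (-1 : ℝ) 1, ∀ y ∈ Ioo (-1 : ℝ) 1, inner ℝ (Φ x) (Φ y) = greenKernel k φ x y
  total : ∀ w, (∀ x ∈ Ioo (-1 : ℝ) 1, inner ℝ (Φ x) w = 0) → w = 0

lemma IsExpSolution.exists_isGreenFeature (hφ : IsExpSolution f k φ) (hk : 0 < k) :
    ∃ (E : Submodule ℝ (Lp ℝ 2 (volume : Measure ℝ))) (Φ : ℝ → E),
      CompleteSpace E ∧ IsGreenFeature k φ Φ := by
  let Ψ : ℝ → Lp ℝ 2 (volume : Measure ℝ) := (Ioo (-1 : ℝ) 1).indicator fun x =>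
    ((√(2 * k))⁻¹ * (φ x)⁻¹) • indicatorConstLp 2 (measurableSet_Ioc (a := 0) (b := φ x ^ 2))
      measure_Ioc_lt_top.ne (1 : ℝ)
  have hmem : ∀ x, Ψ x ∈ (Submodule.span ℝ (range Ψ)).topologicalClosure := fun x =>
    Submodule.le_topologicalClosure _ (Submodule.subset_span (mem_range_self x))
  refine ⟨(Submodule.span ℝ (range Ψ)).topologicalClosure, fun x => ⟨Ψ x, hmem x⟩,
    (Submodule.isClosed_topologicalClosure _).completeSpace_coe, fun x hx y hy => ?_,
    fun w hw => ?_⟩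
  · have hx0 := hφ.pos x hx
    have hy0 := hφ.pos y hy
    have hmin : min (φ x ^ 2) (φ y ^ 2) = min (φ x) (φ y) ^ 2 := by
      rcases le_total (φ x) (φ y) with h | h
      · rw [min_eq_left h, min_eq_left (pow_le_pow_left₀ hx0.le h 2)]
      · rw [min_eq_right h, min_eq_right (pow_le_pow_left₀ hy0.le h 2)]
    rw [Submodule.coe_inner]
    simp only [Ψ, indicator_of_mem hx, indicator_of_mem hy, real_inner_smul_left,
      real_inner_smul_right, L2.real_inner_indicatorConstLp_one_indicatorConstLp_one,
      Ioc_inter_Ioc, sup_idem, measureReal_def, Real.volume_Ioc, sub_zero]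
    rw [ENNReal.toReal_ofReal (by positivity), hmin, greenKernel]
    have hs : (2 * k)⁻¹ = (√(2 * k))⁻¹ * (√(2 * k))⁻¹ := by
      rw [← mul_inv, Real.mul_self_sqrt (by positivity)]
    rw [hs]
    field_simp
  · have hΨ : ∀ x, inner ℝ (Ψ x) (w : Lp ℝ 2 (volume : Measure ℝ)) = 0 := fun x => by
      by_cases hx : x ∈ Ioo (-1 : ℝ) 1
      · exact hw x hx
      · simp only [Ψ, indicator_of_notMem hx, inner_zero_left]
    have hle : (Submodule.span ℝ (range Ψ)).topologicalClosure ≤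
        (ℝ ∙ (w : Lp ℝ 2 (volume : Measure ℝ)))ᗮ := by
      refine Submodule.topologicalClosure_minimal _ ?_ (Submodule.isClosed_orthogonal _)
      rw [Submodule.span_le]
      rintro _ ⟨x, rfl⟩
      rw [SetLike.mem_coe, Submodule.mem_orthogonal_singleton_iff_inner_left]
      exact hΨ x
    have := Submodule.mem_orthogonal_singleton_iff_inner_left.1 (hle w.2)
    exact Subtype.ext (inner_self_eq_zero.1 this)

namespace IsGreenFeature

variable {F : Type*} [NormedAddCommGroup F] [InnerProductSpace ℝ F] {Φ : ℝ → F}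

lemma norm_sq (hΦ : IsGreenFeature k φ Φ) (hφ : IsExpSolution f k φ) {x : ℝ}
    (hx : x ∈ Ioo (-1 : ℝ) 1) : ‖Φ x‖ ^ 2 = (2 * k)⁻¹ := by
  have := hφ.pos x hx
  rw [← real_inner_self_eq_norm_sq, hΦ.inner_eq x hx x hx, greenKernel, min_self]
  field_simp

lemma norm_le (hΦ : IsGreenFeature k φ Φ) (hφ : IsExpSolution f k φ) {x : ℝ}
    (hx : x ∈ Ioo (-1 : ℝ) 1) : ‖Φ x‖ ≤ √(2 * k)⁻¹ :=
  Real.le_sqrt_of_sq_le (hΦ.norm_sq hφ hx).le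

lemma ae_norm_le (hΦ : IsGreenFeature k φ Φ) (hφ : IsExpSolution f k φ) :
    ∀ᵐ x ∂volume.restrict (Ioo (-1 : ℝ) 1), ‖Φ x‖ ≤ √(2 * k)⁻¹ :=
  (ae_restrict_iff' measurableSet_Ioo).2 (ae_of_all _ fun _ hx => hΦ.norm_le hφ hx)

lemma continuousOn (hΦ : IsGreenFeature k φ Φ) (hφ : IsExpSolution f k φ) :
    ContinuousOn Φ (Ioo (-1) 1) := by
  intro y hy
  have hnorm : ∀ x ∈ Ioo (-1 : ℝ) 1,
      √(2 * ((2 * k)⁻¹ - greenKernel k φ x y)) = ‖Φ x - Φ y‖ := fun x hx => by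
    rw [← Real.sqrt_sq (norm_nonneg (Φ x - Φ y)), norm_sub_sq_real, hΦ.norm_sq hφ hx,
      hΦ.norm_sq hφ hy, hΦ.inner_eq x hx y hy]
    ring_nf
  have hcont : ContinuousWithinAt (fun x => √(2 * ((2 * k)⁻¹ - greenKernel k φ x y)))
      (Ioo (-1) 1) y :=
    ((continuousWithinAt_const.sub (hφ.continuousOn_greenKernel_left hy y hy)).const_mul 2).sqrt
  rw [ContinuousWithinAt, tendsto_iff_norm_sub_tendsto_zero]
  have hlim := hcont.tendsto
  rw [hnorm y hy, sub_self, norm_zero] at hlim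
  exact hlim.congr' (eventually_mem_nhdsWithin.mono hnorm)

lemma aestronglyMeasurable (hΦ : IsGreenFeature k φ Φ) (hφ : IsExpSolution f k φ) :
    AEStronglyMeasurable Φ (volume.restrict (Ioo (-1) 1)) :=
  (hΦ.continuousOn hφ).aestronglyMeasurable measurableSet_Ioo

lemma continuousOn_inner (hΦ : IsGreenFeature k φ Φ) (hφ : IsExpSolution f k φ) (v : F) :
    ContinuousOn (fun x => inner ℝ (Φ x) v) (Ioo (-1) 1) :=
  (hΦ.continuousOn hφ).inner continuousOn_const

lemma abs_inner_le (hΦ : IsGreenFeature k φ Φ) (hφ : IsExpSolution f k φ) (v : F) {x : ℝ}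
    (hx : x ∈ Ioo (-1 : ℝ) 1) : |inner ℝ (Φ x) v| ≤ √(2 * k)⁻¹ * ‖v‖ :=
  (abs_real_inner_le_norm _ _).trans (mul_le_mul_of_nonneg_right (hΦ.norm_le hφ hx)
    (norm_nonneg v))

lemma eq_of_inner_eq (hΦ : IsGreenFeature k φ Φ) {v w : F}
    (h : ∀ x ∈ Ioo (-1 : ℝ) 1, inner ℝ (Φ x) v = inner ℝ (Φ x) w) : v = w :=
  sub_eq_zero.1 (hΦ.total _ fun x hx => by rw [inner_sub_right, h x hx, sub_self])

lemma exists_inner_ne_zero (hΦ : IsGreenFeature k φ Φ) {v : F} (hv : v ≠ 0) :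
    ∃ x ∈ Ioo (-1 : ℝ) 1, inner ℝ (Φ x) v ≠ 0 := by
  by_contra! h
  exact hv (hΦ.total v h)

variable [CompleteSpace F]

lemma inner_frameOp_eq_greenPotential (hΦ : IsGreenFeature k φ Φ) (hφ : IsExpSolution f k φ)
    {v : F} {u : ℝ → ℝ} (hu : ∀ x ∈ Ioo (-1 : ℝ) 1, inner ℝ (Φ x) v = u x) {x : ℝ}
    (hx : x ∈ Ioo (-1 : ℝ) 1) :
    inner ℝ (Φ x) (frameOp (volume.restrict (Ioo (-1) 1)) Φ v) = greenPotential k φ u x := by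
  rw [inner_frameOp (hΦ.aestronglyMeasurable hφ) (hΦ.ae_norm_le hφ), greenPotential]
  refine setIntegral_congr_fun measurableSet_Ioo fun y hy => ?_
  rw [hu y hy, hΦ.inner_eq y hy x hx, IsExpSolution.greenKernel_symm, mul_comm]

lemma eq_zero_of_frameOp_eq_zero (hΦ : IsGreenFeature k φ Φ) (hφ : IsExpSolution f k φ) {v : F}
    (hv : frameOp (volume.restrict (Ioo (-1) 1)) Φ v = 0) : v = 0 := by
  have hint := inner_frameOp (hΦ.aestronglyMeasurable hφ) (hΦ.ae_norm_le hφ) v v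
  rw [hv, inner_zero_right] at hint
  have hc : ContinuousOn (fun x => inner ℝ (Φ x) v * inner ℝ (Φ x) v) (Ioo (-1) 1) :=
    (hΦ.continuousOn_inner hφ v).mul (hΦ.continuousOn_inner hφ v)
  have hi : IntegrableOn (fun x => inner ℝ (Φ x) v * inner ℝ (Φ x) v) (Ioo (-1) 1) := by
    refine IntegrableOn.of_bound (by simp) (hc.aestronglyMeasurable measurableSet_Ioo)
      ((√(2 * k)⁻¹ * ‖v‖) * (√(2 * k)⁻¹ * ‖v‖)) ?_
    refine (ae_restrict_iff' measurableSet_Ioo).2 (ae_of_all _ fun y hy => ?_)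
    rw [norm_mul]
    exact mul_self_le_mul_self (norm_nonneg _) (hΦ.abs_inner_le hφ v hy)
  have hae := (integral_eq_zero_iff_of_nonneg (fun x => mul_self_nonneg _) hi).1 hint.symm
  have heq := Measure.eqOn_open_of_ae_eq hae isOpen_Ioo hc continuousOn_const
  exact hΦ.total v fun x hx => mul_self_eq_zero.1 (heq hx)

lemma exists_inner_eq (hΦ : IsGreenFeature k φ Φ) (hφ : IsExpSolution f k φ) {u : ℝ → ℝ}
    {lam C : ℝ} (hu : ContinuousOn u (Ioo (-1) 1)) (hC : ∀ x ∈ Ioo (-1 : ℝ) 1, |u x| ≤ C)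
    (heq : ∀ x ∈ Ioo (-1 : ℝ) 1, u x = lam * greenPotential k φ u x) :
    ∃ v, ∀ x ∈ Ioo (-1 : ℝ) 1, inner ℝ (Φ x) v = u x := by
  have hi : IntegrableOn (fun y => u y • Φ y) (Ioo (-1) 1) := by
    refine IntegrableOn.of_bound (by simp)
      ((hu.smul (hΦ.continuousOn hφ)).aestronglyMeasurable measurableSet_Ioo)
      (C * √(2 * k)⁻¹) ?_
    refine (ae_restrict_iff' measurableSet_Ioo).2 (ae_of_all _ fun y hy => ?_)
    rw [norm_smul]
    exact mul_le_mul (hC y hy) (hΦ.norm_le hφ hy) (norm_nonneg _)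
      ((abs_nonneg _).trans (hC y hy))
  refine ⟨lam • ∫ y in Ioo (-1 : ℝ) 1, u y • Φ y, fun x hx => ?_⟩
  rw [real_inner_smul_right, ← integral_inner hi, heq x hx, greenPotential]
  congr 1
  refine setIntegral_congr_fun measurableSet_Ioo fun y hy => ?_
  rw [real_inner_smul_right, hΦ.inner_eq x hx y hy, mul_comm]

lemma exists_eigenvector {k : ℕ} (hf : IsProfile f) (hk : 1 ≤ k) (hΦ : IsGreenFeature k φ Φ)
    (hφ : IsExpSolution f k φ) {lam : ℝ} (h : lam ∈ Spec f k) :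
    0 < lam ∧ ∃ v, v ≠ 0 ∧ frameOp (volume.restrict (Ioo (-1) 1)) Φ v = (1 / lam) • v := by
  obtain ⟨u, C, hu, hC, ⟨x₀, hx₀, hne⟩, heq⟩ := hφ.exists_eq_greenPotential hf hk h
  obtain ⟨v, hv⟩ := hΦ.exists_inner_eq hφ hu hC heq
  have hlam : lam ≠ 0 := by
    rintro rfl
    exact hne (by rw [heq x₀ hx₀, zero_mul])
  have hv0 : v ≠ 0 := by
    rintro rfl
    exact hne (by rw [← hv x₀ hx₀, inner_zero_right])
  have hB : frameOp (volume.restrict (Ioo (-1) 1)) Φ v = (1 / lam) • v := by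
    refine hΦ.eq_of_inner_eq fun x hx => ?_
    rw [hΦ.inner_frameOp_eq_greenPotential hφ hv hx, real_inner_smul_right, hv x hx, heq x hx]
    field_simp
  refine ⟨?_, v, hv0, hB⟩
  have hint := inner_frameOp (hΦ.aestronglyMeasurable hφ) (hΦ.ae_norm_le hφ) v v
  rw [hB, real_inner_smul_right, real_inner_self_eq_norm_sq] at hint
  have hnonneg : 0 ≤ 1 / lam * ‖v‖ ^ 2 :=
    hint ▸ integral_nonneg fun x => mul_self_nonneg (inner ℝ (Φ x) v)
  have := nonneg_of_mul_nonneg_left hnonneg (by positivity)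
  exact lt_of_le_of_ne (one_div_nonneg.1 this) hlam.symm

lemma eq_inv_mul_greenPotential (hΦ : IsGreenFeature k φ Φ) (hφ : IsExpSolution f k φ) {v : F}
    {r : ℝ} (hr : r ≠ 0) (hv : frameOp (volume.restrict (Ioo (-1) 1)) Φ v = r • v) :
    ∀ x ∈ Ioo (-1 : ℝ) 1,
      inner ℝ (Φ x) v = r⁻¹ * greenPotential k φ (fun y => inner ℝ (Φ y) v) x := fun x hx => by
  rw [← hΦ.inner_frameOp_eq_greenPotential hφ (fun _ _ => rfl) hx, hv, real_inner_smul_right,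
    inv_mul_cancel_left₀ hr]

lemma inv_mem_spec {k : ℕ} (hf : IsProfile f) (hk : 1 ≤ k) (hΦ : IsGreenFeature k φ Φ)
    (hφ : IsExpSolution f k φ) {v : F} {r : ℝ} (hr : r ≠ 0) (hv0 : v ≠ 0)
    (hv : frameOp (volume.restrict (Ioo (-1) 1)) Φ v = r • v) : r⁻¹ ∈ Spec f k :=
  hφ.inSpec_of_eq_greenPotential hf hk (hΦ.continuousOn_inner hφ v)
    (fun _ hx => hΦ.abs_inner_le hφ v hx) (hΦ.exists_inner_ne_zero hv0)
    (hΦ.eq_inv_mul_greenPotential hφ hr hv)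

lemma exists_eq_smul (hf : IsProfile f) (hk : 0 < k) (hΦ : IsGreenFeature k φ Φ)
    (hφ : IsExpSolution f k φ) {v w : F} {r : ℝ} (hr : r ≠ 0) (hw0 : w ≠ 0)
    (hw : frameOp (volume.restrict (Ioo (-1) 1)) Φ w = r • w)
    (hv : frameOp (volume.restrict (Ioo (-1) 1)) Φ v = r • v) : ∃ c : ℝ, v = c • w := by
  obtain ⟨c, hc⟩ := hφ.exists_eq_mul_of_eq_greenPotential hf hk (hΦ.continuousOn_inner hφ w)
    (fun _ hx => hΦ.abs_inner_le hφ w hx) (hΦ.exists_inner_ne_zero hw0)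
    (hΦ.eq_inv_mul_greenPotential hφ hr hw) (hΦ.continuousOn_inner hφ v)
    (fun _ hx => hΦ.abs_inner_le hφ v hx) (hΦ.eq_inv_mul_greenPotential hφ hr hv)
  exact ⟨c, hΦ.eq_of_inner_eq fun x hx => by rw [hc x hx, real_inner_smul_right]⟩

end IsGreenFeature

end FeatureMap

/-- Trace formula: the eigenvalues of `L_k` (for `k ≥ 1`) are positive and the sum of
their reciprocals is `1/k`. -/
theorem trace_formula (f : ℝ → ℝ) (hf : IsProfile f) (k : ℕ) (hk : 1 ≤ k)
    (μ : ℕ → ℝ) (hmono : StrictMono μ) (hrange : Set.range μ = Spec f k) :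
    (∀ j, 0 < μ j) ∧ Summable (fun j => 1 / μ j) ∧ ∑' j, 1 / μ j = 1 / (k : ℝ) := by
  have hk0 : (0 : ℝ) < k := by exact_mod_cast hk
  obtain ⟨φ, hφ⟩ := hf.exists_isExpSolution hk0
  obtain ⟨E, Φ, _, hΦ⟩ := hφ.exists_isGreenFeature hk0
  have hμ : ∀ j, 0 < μ j ∧ ∃ v, v ≠ 0 ∧
      frameOp (volume.restrict (Ioo (-1) 1)) Φ v = (1 / μ j) • v := fun j =>
    hΦ.exists_eigenvector hf hk hφ (hrange ▸ mem_range_self j)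
  choose hpos e he0 he using hμ
  have hsum : HasSum (fun j => 1 / μ j) (∫ x in Ioo (-1 : ℝ) 1, ‖Φ x‖ ^ 2) := by
    refine hasSum_simple_eigenvalues_frameOp (hΦ.aestronglyMeasurable hφ) (hΦ.ae_norm_le hφ)
      (fun v => hΦ.eq_zero_of_frameOp_eq_zero hφ) (fun i j hij => hmono.injective ?_) he0 he
      fun v r hr hv0 hv => ?_
    · simpa using hij
    · obtain ⟨j, hj⟩ : r⁻¹ ∈ range μ := hrange ▸ hΦ.inv_mem_spec hf hk hφ hr hv0 hv
      have hrj : 1 / μ j = r := by rw [hj, one_div, inv_inv]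
      exact ⟨j, hΦ.exists_eq_smul hf hk0 hφ hr (he0 j) (hrj ▸ he j) hv⟩
  have htrace : ∫ x in Ioo (-1 : ℝ) 1, ‖Φ x‖ ^ 2 = 1 / k := by
    rw [setIntegral_congr_fun measurableSet_Ioo fun x hx => hΦ.norm_sq hφ hx, setIntegral_const,
      measureReal_def, Real.volume_Ioo, ENNReal.toReal_ofReal (by norm_num), smul_eq_mul]
    field_simp
    norm_num
  rw [htrace] at hsum
  exact ⟨hpos, hsum.summable, hsum.tsum_eq⟩
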